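/- Let H be a Hilbert space and suppose the update function Φ is a contraction in expectation with constant r < 1, i.e. E[‖Φ(x,ξ)−Φ(y,ξ)‖²] ≤ r²‖x−y‖² for all x,y ∈ H, and suppose there exists y ∈ H with E[‖Φ(y,ξ)−y‖²] < ∞. Then the Markov operator 𝒫 maps P₂(H) into itself, there exists a unique invariant probability measure π ∈ P₂(H) for 𝒫, and W₂(μ₀𝒫ⁿ, π) ≤ rⁿ W₂(μ₀, π) for all μ₀ ∈ P₂(H) and all n ∈ ℕ; that is, the sequence μ_{k+1} := μ_k𝒫 converges Q-linearly (geometrically) to π in W₂ from any initial measure μ₀ ∈ P₂(H). -/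

import Mathlib

open MeasureTheory Filter Topology

noncomputable section

/-- One application of the dual Markov operator of the RFI, with `μξ` the law of `ξ`. -/
def markovStep {G I : Type*} [MeasurableSpace G] [MeasurableSpace I]
    (μξ : MeasureTheory.Measure I) (T : I → G → G) (μ : MeasureTheory.Measure G) :
    MeasureTheory.Measure G :=
  μ.bind fun x => μξ.map fun i => T i x

/-- Squared distance `‖x - y‖²` as an extended nonnegative real. -/
def q2 {H : Type*} [NormedAddCommGroup H] (x y : H) : ENNReal :=
  (‖x - y‖₊ : ENNReal) ^ 2

/-- `γ` is a coupling of `(μ, ν)`: a measure on the product with marginals `μ` and `ν`. -/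
def IsCoupling {H : Type*} [MeasurableSpace H]
    (γ : MeasureTheory.Measure (H × H)) (μ ν : MeasureTheory.Measure H) : Prop :=
  γ.map Prod.fst = μ ∧ γ.map Prod.snd = ν

/-- The squared Wasserstein-2 distance `W₂(μ,ν)²`. -/
def W2sq {H : Type*} [MeasurableSpace H] [NormedAddCommGroup H]
    (μ ν : MeasureTheory.Measure H) : ENNReal :=
  ⨅ (γ : MeasureTheory.Measure (H × H)) (_ : IsCoupling γ μ ν), ∫⁻ p, q2 p.1 p.2 ∂γ

/-- An optimal coupling of `(μ, ν)`: a coupling attaining `W₂(μ,ν)²`. -/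
def IsOptCoupling {H : Type*} [MeasurableSpace H] [NormedAddCommGroup H]
    (γ : MeasureTheory.Measure (H × H)) (μ ν : MeasureTheory.Measure H) : Prop :=
  IsCoupling γ μ ν ∧ ∫⁻ p, q2 p.1 p.2 ∂γ = W2sq μ ν

/-- Membership in `P₂(H)`: probability measures with finite second moment. -/
def MemP2 {H : Type*} [MeasurableSpace H] [NormedAddCommGroup H]
    (μ : MeasureTheory.Measure H) : Prop :=
  MeasureTheory.IsProbabilityMeasure μ ∧ ∃ x : H, ∫⁻ y, q2 x y ∂μ < ⊤

section Coupling

variable {H : Type*} [MeasurableSpace H]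

lemma IsCoupling.isProbabilityMeasure {γ : Measure (H × H)} {μ ν : Measure H}
    [IsProbabilityMeasure μ] (hγ : IsCoupling γ μ ν) : IsProbabilityMeasure γ := by
  constructor
  have h := congrArg (fun m => m Set.univ) hγ.1
  simpa [Measure.map_apply measurable_fst MeasurableSet.univ] using h

lemma IsCoupling.prod (μ ν : Measure H) [IsProbabilityMeasure μ] [IsProbabilityMeasure ν] :
    IsCoupling (μ.prod ν) μ ν := by
  constructor <;> simp

end Coupling

section Transport

variable {H : Type*} [NormedAddCommGroup H]

lemma q2_eq_edist_sq (x y : H) : q2 x y = edist x y ^ 2 := by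
  simp [q2, edist_eq_enorm_sub, enorm_eq_nnnorm]

lemma q2_comm (x y : H) : q2 x y = q2 y x := by
  simp [q2_eq_edist_sq, edist_comm]

lemma q2_triangle (x y z : H) : q2 x z ≤ 2 * q2 x y + 2 * q2 y z := by
  have h : ‖x - z‖ ^ 2 ≤ 2 * ‖x - y‖ ^ 2 + 2 * ‖y - z‖ ^ 2 := by
    have h1 := norm_sub_le_norm_sub_add_norm_sub x y z
    nlinarith [norm_nonneg (x - z), sq_nonneg (‖x - y‖ - ‖y - z‖)]
  have h' : ‖x - z‖₊ ^ 2 ≤ 2 * ‖x - y‖₊ ^ 2 + 2 * ‖y - z‖₊ ^ 2 := by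
    exact_mod_cast h
  unfold q2
  exact_mod_cast h'

variable [MeasurableSpace H]

lemma IsCoupling.W2sq_le {γ : Measure (H × H)} {μ ν : Measure H} (hγ : IsCoupling γ μ ν) :
    W2sq μ ν ≤ ∫⁻ p, q2 p.1 p.2 ∂γ :=
  iInf₂_le γ hγ

variable [BorelSpace H] [SecondCountableTopology H]

lemma measurable_q2 : Measurable fun p : H × H => q2 p.1 p.2 := by
  simp only [q2_eq_edist_sq]
  fun_prop

lemma Measurable.q2 {α : Type*} [MeasurableSpace α] {f g : α → H} (hf : Measurable f)
    (hg : Measurable g) : Measurable fun a => q2 (f a) (g a) :=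
  measurable_q2.comp (hf.prodMk hg)

lemma two_mul_add_two_mul_lt_top {a b : ENNReal} (ha : a < ⊤) (hb : b < ⊤) :
    2 * a + 2 * b < ⊤ := by
  finiteness

lemma MemP2.lintegral_q2_lt_top {μ : Measure H} (hμ : MemP2 μ) (y : H) :
    ∫⁻ x, q2 y x ∂μ < ⊤ := by
  obtain ⟨hprob, z, hz⟩ := hμ
  have hm : Measurable fun x => q2 z x := measurable_const.q2 measurable_id
  calc ∫⁻ x, q2 y x ∂μ ≤ ∫⁻ x, (2 * q2 y z + 2 * q2 z x) ∂μ :=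
        lintegral_mono fun x => q2_triangle y z x
    _ = 2 * q2 y z + 2 * ∫⁻ x, q2 z x ∂μ := by
        rw [lintegral_add_left measurable_const, lintegral_const_mul _ hm]
        simp
    _ < ⊤ := two_mul_add_two_mul_lt_top (by simp [q2]) hz

lemma W2sq_lt_top {μ ν : Measure H} (hμ : MemP2 μ) (hν : MemP2 ν) : W2sq μ ν < ⊤ := by
  have := hμ.1
  have := hν.1
  refine (IsCoupling.prod μ ν).W2sq_le.trans_lt ?_
  have hm : Measurable fun x : H => q2 0 x := measurable_const.q2 measurable_id
  have hm1 : Measurable fun p : H × H => q2 0 p.1 := measurable_const.q2 measurable_fst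
  have hm2 : Measurable fun p : H × H => q2 0 p.2 := measurable_const.q2 measurable_snd
  calc ∫⁻ p, q2 p.1 p.2 ∂μ.prod ν
      ≤ ∫⁻ p, (2 * q2 0 p.1 + 2 * q2 0 p.2) ∂μ.prod ν :=
        lintegral_mono fun p => by
          rw [q2_comm 0 p.1]
          exact q2_triangle p.1 0 p.2
    _ = 2 * ∫⁻ x, q2 0 x ∂μ + 2 * ∫⁻ x, q2 0 x ∂ν := by
        rw [lintegral_add_left (hm1.const_mul 2), lintegral_const_mul _ hm1,
          lintegral_const_mul _ hm2]
        rw [← lintegral_map hm measurable_fst, ← lintegral_map hm measurable_snd,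
          (IsCoupling.prod μ ν).1, (IsCoupling.prod μ ν).2]
    _ < ⊤ := two_mul_add_two_mul_lt_top (hμ.lintegral_q2_lt_top 0) (hν.lintegral_q2_lt_top 0)

lemma eq_of_W2sq_eq_zero {μ ν : Measure H} [IsProbabilityMeasure μ] [IsProbabilityMeasure ν]
    (h : W2sq μ ν = 0) : μ = ν := by
  have hLP : levyProkhorovEDist μ ν = 0 := by
    refine le_antisymm (levyProkhorovEDist_le_of_forall_le μ ν 0 fun ε B hε hε_top hB => ?_)
      zero_le
    have hlt : W2sq μ ν < ε ^ 2 * ε := by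
      rw [h]
      exact ENNReal.mul_pos (pow_ne_zero 2 hε.ne') hε.ne'
    simp only [W2sq, iInf_lt_iff] at hlt
    obtain ⟨γ, hγ, hlt⟩ := hlt
    have hbad : γ {p | ε ^ 2 ≤ q2 p.1 p.2} ≤ ε := by
      refine (meas_ge_le_lintegral_div measurable_q2.aemeasurable (pow_ne_zero 2 hε.ne')
        (ENNReal.pow_ne_top hε_top.ne)).trans ?_
      refine ENNReal.div_le_of_le_mul ?_
      rw [mul_comm]
      exact hlt.le
    have hthick : MeasurableSet (Metric.thickening ε.toReal B) :=
      Metric.isOpen_thickening.measurableSet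
    calc μ B = γ (Prod.fst ⁻¹' B) := by
          rw [← hγ.1, Measure.map_apply measurable_fst hB]
      _ ≤ γ (Prod.snd ⁻¹' Metric.thickening ε.toReal B ∪ {p | ε ^ 2 ≤ q2 p.1 p.2}) := by
          refine measure_mono fun p hp => ?_
          by_cases hq : ε ^ 2 ≤ q2 p.1 p.2
          · exact Or.inr hq
          · refine Or.inl (Metric.mem_thickening_iff.2 ⟨p.1, hp, ?_⟩)
            rw [q2_eq_edist_sq, not_le] at hq
            have hd : edist p.1 p.2 < ε := lt_of_pow_lt_pow_left' 2 hq
            rw [dist_comm, dist_edist]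
            exact (ENNReal.toReal_lt_toReal (edist_ne_top _ _) hε_top.ne).2 hd
      _ ≤ γ (Prod.snd ⁻¹' Metric.thickening ε.toReal B) + γ {p | ε ^ 2 ≤ q2 p.1 p.2} :=
          measure_union_le _ _
      _ ≤ ν (Metric.thickening ε.toReal B) + ε := by
          rw [← hγ.2, Measure.map_apply measurable_snd hthick]
          gcongr
  refine ext_of_generate_finite _ ?_ isPiSystem_isClosed (fun A hA => ?_) (by simp)
  · rw [BorelSpace.measurable_eq (α := H), borel_eq_generateFrom_isClosed]
  · exact measure_eq_measure_of_levyProkhorovEDist_eq_zero_of_isClosed hLP hA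
      ⟨1, one_pos, measure_ne_top _ _⟩ ⟨1, one_pos, measure_ne_top _ _⟩

end Transport

section Shift

variable {I : Type*} [MeasurableSpace I]

/-- Prepend a term to a sequence. -/
def seqCons (p : I × (ℕ → I)) : ℕ → I
  | 0 => p.1
  | n + 1 => p.2 n

lemma measurable_seqCons : Measurable (seqCons : I × (ℕ → I) → ℕ → I) := by
  refine measurable_pi_lambda _ fun n => ?_
  cases n with
  | zero => exact measurable_fst
  | succ n => exact (measurable_pi_apply n).comp measurable_snd

lemma map_seqCons_infinitePi (μ : Measure I) [IsProbabilityMeasure μ] :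
    (μ.prod (Measure.infinitePi fun _ : ℕ => μ)).map seqCons =
      Measure.infinitePi fun _ : ℕ => μ := by
  classical
  refine Measure.eq_infinitePi _ fun s t ht => ?_
  obtain ⟨N, hN⟩ := s.exists_nat_subset_range
  have hs : s ⊆ Finset.range (N + 1) := hN.trans (Finset.range_subset_range.2 N.le_succ)
  set u : ℕ → Set I := fun i => if i ∈ s then t i else Set.univ with hu
  have hum : ∀ i, MeasurableSet (u i) := fun i => by
    by_cases hi : i ∈ s <;> simp [hu, hi, ht i]
  have hpre : seqCons ⁻¹' (Set.pi s t) =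
      u 0 ×ˢ Set.pi (Finset.range N : Finset ℕ) fun i => u (i + 1) := by
    ext p
    simp only [Set.mem_preimage, Set.mem_pi, Finset.mem_coe, Set.mem_prod, Finset.mem_range]
    constructor
    · intro h
      refine ⟨?_, fun i _ => ?_⟩
      · by_cases h0 : 0 ∈ s
        · simpa [hu, h0, seqCons] using h 0 h0
        · simp [hu, h0]
      · by_cases h0 : i + 1 ∈ s
        · simpa [hu, h0, seqCons] using h (i + 1) h0
        · simp [hu, h0]
    · rintro ⟨h0, h1⟩ i hi
      cases i with
      | zero => simpa [hu, hi, seqCons] using h0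
      | succ n =>
        have hn := Finset.mem_range.1 (hs hi)
        simpa [hu, hi, seqCons] using h1 n (by lia)
  have hprod : ∏ i ∈ s, μ (t i) = ∏ i ∈ Finset.range (N + 1), μ (u i) := by
    rw [← Finset.prod_subset hs fun i _ hi => by simp [hu, hi]]
    exact Finset.prod_congr rfl fun i hi => by simp [hu, hi]
  rw [Measure.map_apply measurable_seqCons (MeasurableSet.pi s.countable_toSet fun i _ => ht i),
    hpre, Measure.prod_prod, Measure.infinitePi_pi _ fun i _ => hum (i + 1), hprod,
    Finset.prod_range_succ', mul_comm]

lemma measurePreserving_headTail (μ : Measure I) [IsProbabilityMeasure μ] :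
    MeasurePreserving (fun ω : ℕ → I => (ω 0, fun n => ω (n + 1)))
      (Measure.infinitePi fun _ : ℕ => μ) (μ.prod (Measure.infinitePi fun _ : ℕ => μ)) := by
  have hm : Measurable fun ω : ℕ → I => (ω 0, fun n => ω (n + 1)) := by fun_prop
  refine ⟨hm, ?_⟩
  nth_rewrite 1 [← map_seqCons_infinitePi μ]
  rw [Measure.map_map hm measurable_seqCons]
  exact Measure.map_id

end Shift

section MarkovStep

variable {H I : Type*} [MeasurableSpace H] [MeasurableSpace I] {T : I → H → H}

lemma markovStep_eq_map (hΦ : Measurable fun p : H × I => T p.2 p.1) (μξ : Measure I)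
    [IsProbabilityMeasure μξ] (μ : Measure H) [SFinite μ] :
    markovStep μξ T μ = (μ.prod μξ).map fun p => T p.2 p.1 := by
  have hpre : ∀ (x : H) (s : Set H), MeasurableSet s →
      (μξ.map fun i => T i x) s = μξ (Prod.mk x ⁻¹' ((fun p : H × I => T p.2 p.1) ⁻¹' s)) :=
    fun x s hs => Measure.map_apply (hΦ.comp measurable_prodMk_left) hs
  have hmeas : Measurable fun x => μξ.map fun i => T i x := by
    refine Measure.measurable_of_measurable_coe _ fun s hs => ?_
    simp only [hpre _ s hs]
    exact measurable_measure_prodMk_left (hΦ hs)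
  ext s hs
  rw [markovStep, Measure.bind_apply hs hmeas.aemeasurable, Measure.map_apply hΦ hs,
    Measure.prod_apply (hΦ hs)]
  simp only [hpre _ s hs]

lemma isProbabilityMeasure_markovStep (hΦ : Measurable fun p : H × I => T p.2 p.1)
    (μξ : Measure I) [IsProbabilityMeasure μξ] (μ : Measure H) [IsProbabilityMeasure μ] :
    IsProbabilityMeasure (markovStep μξ T μ) := by
  rw [markovStep_eq_map hΦ]
  exact Measure.isProbabilityMeasure_map hΦ.aemeasurable

lemma map_update_eq_markovStep {Ω : Type*} [MeasurableSpace Ω] {μξ : Measure I}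
    [IsProbabilityMeasure μξ] {P : Measure Ω} [IsProbabilityMeasure P]
    (hΦ : Measurable fun p : H × I => T p.2 p.1) {X : Ω → H} (hX : Measurable X) :
    (μξ.prod P).map (fun p => T p.1 (X p.2)) = markovStep μξ T (P.map X) := by
  have := Measure.isProbabilityMeasure_map (μ := P) hX.aemeasurable
  have hm : Measurable fun p : I × Ω => T p.1 (X p.2) :=
    hΦ.comp ((hX.comp measurable_snd).prodMk measurable_fst)
  rw [markovStep_eq_map hΦ]
  nth_rewrite 2 [← Measure.map_id (μ := μξ)]
  rw [Measure.map_prod_map _ _ hX measurable_id, Measure.map_map hΦ (hX.prodMap measurable_id),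
    ← Measure.prod_swap, Measure.map_map hm measurable_swap]
  rfl

variable [NormedAddCommGroup H] [BorelSpace H] [SecondCountableTopology H]
  {μξ : Measure I} [IsProbabilityMeasure μξ] {c : ENNReal}

lemma lintegral_q2_update_lt_top (hΦ : Measurable fun p : H × I => T p.2 p.1)
    (hc : c ≠ ⊤) (hcontr : ∀ x y : H, ∫⁻ i, q2 (T i x) (T i y) ∂μξ ≤ c * q2 x y)
    {y : H} (hy : ∫⁻ i, q2 (T i y) y ∂μξ < ⊤) {μ : Measure H} (hμ : MemP2 μ) :
    ∫⁻ p, q2 y (T p.2 p.1) ∂μ.prod μξ < ⊤ := by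
  have := hμ.1
  have hm : Measurable fun p : H × I => q2 (T p.2 y) (T p.2 p.1) :=
    (hΦ.comp (measurable_const.prodMk measurable_snd)).q2 hΦ
  have hm' : Measurable fun p : H × I => q2 (T p.2 y) y :=
    (hΦ.comp (measurable_const.prodMk measurable_snd)).q2 measurable_const
  have hmy : Measurable fun x => q2 y x := measurable_const.q2 measurable_id
  calc ∫⁻ p, q2 y (T p.2 p.1) ∂μ.prod μξ
      ≤ ∫⁻ p, (2 * q2 (T p.2 y) y + 2 * q2 (T p.2 y) (T p.2 p.1)) ∂μ.prod μξ :=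
        lintegral_mono fun p => by
          rw [q2_comm _ y]
          exact q2_triangle _ _ _
    _ = 2 * ∫⁻ i, q2 (T i y) y ∂μξ + 2 * ∫⁻ x, ∫⁻ i, q2 (T i y) (T i x) ∂μξ ∂μ := by
        rw [lintegral_add_right _ (hm.const_mul 2), lintegral_const_mul _ hm,
          lintegral_const_mul _ hm', lintegral_prod _ hm.aemeasurable,
          lintegral_prod _ hm'.aemeasurable]
        simp
    _ ≤ 2 * ∫⁻ i, q2 (T i y) y ∂μξ + 2 * ∫⁻ x, c * q2 y x ∂μ := by
        gcongr with x
        exact hcontr y x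
    _ < ⊤ := by
        rw [lintegral_const_mul _ hmy]
        exact two_mul_add_two_mul_lt_top hy
          (ENNReal.mul_lt_top hc.lt_top (hμ.lintegral_q2_lt_top y))

lemma memP2_markovStep (hΦ : Measurable fun p : H × I => T p.2 p.1)
    (hc : c ≠ ⊤) (hcontr : ∀ x y : H, ∫⁻ i, q2 (T i x) (T i y) ∂μξ ≤ c * q2 x y)
    {y : H} (hy : ∫⁻ i, q2 (T i y) y ∂μξ < ⊤) {μ : Measure H} (hμ : MemP2 μ) :
    MemP2 (markovStep μξ T μ) := by
  have := hμ.1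
  refine ⟨isProbabilityMeasure_markovStep hΦ μξ μ, y, ?_⟩
  have hm : Measurable fun x => q2 y x := measurable_const.q2 measurable_id
  rw [markovStep_eq_map hΦ, lintegral_map hm hΦ]
  exact lintegral_q2_update_lt_top hΦ hc hcontr hy hμ

lemma W2sq_markovStep_le (hΦ : Measurable fun p : H × I => T p.2 p.1)
    (hc : c ≠ ⊤) (hcontr : ∀ x y : H, ∫⁻ i, q2 (T i x) (T i y) ∂μξ ≤ c * q2 x y)
    (μ ν : Measure H) [IsProbabilityMeasure μ] [IsProbabilityMeasure ν] :
    W2sq (markovStep μξ T μ) (markovStep μξ T ν) ≤ c * W2sq μ ν := by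
  have hne : Nonempty {γ : Measure (H × H) // IsCoupling γ μ ν} := ⟨_, IsCoupling.prod μ ν⟩
  rw [W2sq.eq_1 μ ν, iInf_subtype', ENNReal.mul_iInf fun h => absurd h hc]
  refine le_iInf fun ⟨γ, hγ⟩ => ?_
  have := hγ.isProbabilityMeasure
  let F : (H × H) × I → H × H := fun p => (T p.2 p.1.1, T p.2 p.1.2)
  have hF1 : Measurable fun p : (H × H) × I => (p.1.1, p.2) := by fun_prop
  have hF2 : Measurable fun p : (H × H) × I => (p.1.2, p.2) := by fun_prop
  have hF : Measurable F := (hΦ.comp hF1).prodMk (hΦ.comp hF2)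
  have hcoup : IsCoupling ((γ.prod μξ).map F) (markovStep μξ T μ) (markovStep μξ T ν) := by
    constructor
    · rw [Measure.map_map measurable_fst hF, markovStep_eq_map hΦ, ← hγ.1]
      nth_rewrite 2 [← Measure.map_id (μ := μξ)]
      rw [Measure.map_prod_map _ _ measurable_fst measurable_id,
        Measure.map_map hΦ (measurable_fst.prodMap measurable_id)]
      rfl
    · rw [Measure.map_map measurable_snd hF, markovStep_eq_map hΦ, ← hγ.2]
      nth_rewrite 2 [← Measure.map_id (μ := μξ)]
      rw [Measure.map_prod_map _ _ measurable_snd measurable_id,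
        Measure.map_map hΦ (measurable_snd.prodMap measurable_id)]
      rfl
  refine hcoup.W2sq_le.trans ?_
  calc ∫⁻ p, q2 p.1 p.2 ∂(γ.prod μξ).map F
      = ∫⁻ p, ∫⁻ i, q2 (T i p.1) (T i p.2) ∂μξ ∂γ := by
        rw [lintegral_map measurable_q2 hF]
        exact lintegral_prod _ (measurable_q2.comp hF).aemeasurable
    _ ≤ ∫⁻ p, c * q2 p.1 p.2 ∂γ := lintegral_mono fun p => hcontr p.1 p.2
    _ = c * ∫⁻ p, q2 p.1 p.2 ∂γ := lintegral_const_mul _ measurable_q2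

end MarkovStep

section Invariant

variable {H Ω : Type*} [NormedAddCommGroup H] [MeasurableSpace Ω] {P : Measure Ω}

lemma lintegral_q2_eq_eLpNorm_sq (X Y : Ω → H) :
    ∫⁻ ω, q2 (X ω) (Y ω) ∂P = eLpNorm (X - Y) 2 P ^ 2 := by
  have h := eLpNorm_nnreal_pow_eq_lintegral (f := X - Y) (μ := P) (p := 2) two_ne_zero
  simp only [NNReal.coe_ofNat, ENNReal.rpow_ofNat] at h
  exact h.symm

variable [MeasurableSpace H] [BorelSpace H] [SecondCountableTopology H]

lemma memP2_map_iff_memLp [IsProbabilityMeasure P] {X : Ω → H} (hX : Measurable X) :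
    MemP2 (P.map X) ↔ MemLp X 2 P := by
  have hm : Measurable fun x : H => q2 x 0 := measurable_id.q2 measurable_const
  have hkey : ∫⁻ x, q2 x 0 ∂P.map X = eLpNorm X 2 P ^ 2 := by
    rw [lintegral_map hm hX]
    simpa using lintegral_q2_eq_eLpNorm_sq (P := P) X 0
  constructor
  · intro h
    have h0 := h.lintegral_q2_lt_top 0
    simp only [q2_comm (0 : H)] at h0
    rw [hkey] at h0
    exact ⟨hX.aestronglyMeasurable, by simpa using h0⟩
  · intro h
    refine ⟨Measure.isProbabilityMeasure_map hX.aemeasurable, 0, ?_⟩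
    simp only [q2_comm (0 : H)]
    rw [hkey]
    exact ENNReal.pow_lt_top h.2

variable {I : Type*} [MeasurableSpace I] {T : I → H → H} {μξ : Measure I}
  [IsProbabilityMeasure μξ] {c : ENNReal}

lemma lintegral_q2_update_le [SFinite P] (hΦ : Measurable fun p : H × I => T p.2 p.1)
    (hcontr : ∀ x y : H, ∫⁻ i, q2 (T i x) (T i y) ∂μξ ≤ c * q2 x y)
    {X Y : Ω → H} (hX : Measurable X) (hY : Measurable Y) :
    ∫⁻ p, q2 (T p.1 (X p.2)) (T p.1 (Y p.2)) ∂μξ.prod P ≤ c * ∫⁻ ω, q2 (X ω) (Y ω) ∂P := by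
  have hm : Measurable fun p : I × Ω => q2 (T p.1 (X p.2)) (T p.1 (Y p.2)) :=
    (hΦ.comp ((hX.comp measurable_snd).prodMk measurable_fst)).q2
      (hΦ.comp ((hY.comp measurable_snd).prodMk measurable_fst))
  rw [lintegral_prod_symm _ hm.aemeasurable, ← lintegral_const_mul _ (hX.q2 hY)]
  exact lintegral_mono fun ω => hcontr _ _

lemma exists_memP2_markovStep_eq_self [CompleteSpace H]
    (hΦ : Measurable fun p : H × I => T p.2 p.1) {r : ℝ} (hr0 : 0 ≤ r) (hr1 : r < 1)
    (hcontr : ∀ x y : H, ∫⁻ i, q2 (T i x) (T i y) ∂μξ ≤ ENNReal.ofReal (r ^ 2) * q2 x y)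
    {y : H} (hy : ∫⁻ i, q2 (T i y) y ∂μξ < ⊤) :
    ∃ π : Measure H, MemP2 π ∧ markovStep μξ T π = π := by
  let ℙ : Measure (ℕ → I) := Measure.infinitePi fun _ => μξ
  let e : (ℕ → I) → I × (ℕ → I) := fun ω => (ω 0, fun n => ω (n + 1))
  have he : MeasurePreserving e ℙ (μξ.prod ℙ) := measurePreserving_headTail μξ
  have hXm (X : Lp H 2 ℙ) : Measurable X := (Lp.stronglyMeasurable X).measurable
  let G (X : Lp H 2 ℙ) : I × (ℕ → I) → H := fun p => T p.1 (X p.2)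
  have hGm (X : Lp H 2 ℙ) : Measurable (G X) :=
    hΦ.comp (((hXm X).comp measurable_snd).prodMk measurable_fst)
  have hlaw (X : Lp H 2 ℙ) : ℙ.map (G X ∘ e) = markovStep μξ T (ℙ.map X) := by
    rw [← Measure.map_map (hGm X) he.measurable, he.map_eq, map_update_eq_markovStep hΦ (hXm X)]
  have hLp (X : Lp H 2 ℙ) : MemLp (G X ∘ e) 2 ℙ := by
    rw [← memP2_map_iff_memLp ((hGm X).comp he.measurable), hlaw]
    exact memP2_markovStep hΦ ENNReal.ofReal_ne_top hcontr hy
      ((memP2_map_iff_memLp (hXm X)).2 (Lp.memLp X))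
  let F (X : Lp H 2 ℙ) : Lp H 2 ℙ := (hLp X).toLp _
  have hF : ContractingWith r.toNNReal F := by
    refine ⟨by simpa using hr1, fun X Y => ?_⟩
    have hsq : edist (F X) (F Y) ^ 2 ≤ ((r.toNNReal : ENNReal) * edist X Y) ^ 2 := by
      rw [Lp.edist_toLp_toLp, Lp.edist_def, ← lintegral_q2_eq_eLpNorm_sq, mul_pow,
        ← lintegral_q2_eq_eLpNorm_sq]
      have h := he.lintegral_comp ((hGm X).q2 (hGm Y))
      refine h.le.trans ((lintegral_q2_update_le hΦ hcontr (hXm X) (hXm Y)).trans_eq ?_)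
      rw [ENNReal.ofReal_pow hr0, ENNReal.ofReal]
    exact (ENNReal.pow_le_pow_left_iff two_ne_zero).1 hsq
  have hfix : F hF.fixedPoint = hF.fixedPoint := hF.fixedPoint_isFixedPt
  refine ⟨ℙ.map hF.fixedPoint, (memP2_map_iff_memLp (hXm _)).2 (Lp.memLp _), ?_⟩
  rw [← hlaw]
  refine Measure.map_congr ?_
  have hae := (hLp hF.fixedPoint).coeFn_toLp
  rw [show (hLp hF.fixedPoint).toLp _ = hF.fixedPoint from hfix] at hae
  exact hae.symm

end Invariant

/-- contractions in expectation: if the update function `Φ(x,i) = T i x`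
on a Hilbert space is a contraction in expectation with constant `r < 1`
(`E[‖Φ(x,ξ)-Φ(y,ξ)‖²] ≤ r²‖x-y‖²`) and `E[‖Φ(y₀,ξ) - y₀‖²] < ∞` for some `y₀`, then the
Markov operator maps `P₂(H)` into itself, there is a unique invariant probability
measure `π ∈ P₂(H)`, and `W₂(μ₀𝒫ⁿ, π) ≤ rⁿ W₂(μ₀, π)` for all `μ₀ ∈ P₂(H)`
(Q-linear/geometric convergence). -/
theorem stmt12
    {H I : Type*} [NormedAddCommGroup H] [InnerProductSpace ℝ H] [CompleteSpace H]
    [SecondCountableTopology H] [MeasurableSpace H] [BorelSpace H] [MeasurableSpace I]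
    (T : I → H → H)
    (hΦ : Measurable fun p : H × I => T p.2 p.1)
    (μξ : Measure I) [IsProbabilityMeasure μξ]
    (r : ℝ) (hr0 : 0 ≤ r) (hr1 : r < 1)
    (hcontr : ∀ x y : H,
      ∫⁻ i, q2 (T i x) (T i y) ∂μξ ≤ ENNReal.ofReal (r ^ 2) * q2 x y)
    (hfin : ∃ y₀ : H, ∫⁻ i, q2 (T i y₀) y₀ ∂μξ < ⊤) :
    (∀ μ : Measure H, MemP2 μ → MemP2 (markovStep μξ T μ)) ∧
    ∃ π : Measure H, MemP2 π ∧ markovStep μξ T π = π ∧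
      (∀ π' : Measure H, MemP2 π' → markovStep μξ T π' = π' → π' = π) ∧
      ∀ μ₀ : Measure H, MemP2 μ₀ → ∀ n : ℕ,
        W2sq ((markovStep μξ T)^[n] μ₀) π ≤ ENNReal.ofReal (r ^ 2) ^ n * W2sq μ₀ π := by
  obtain ⟨y, hy⟩ := hfin
  have hmap : ∀ μ : Measure H, MemP2 μ → MemP2 (markovStep μξ T μ) := fun μ hμ =>
    memP2_markovStep hΦ ENNReal.ofReal_ne_top hcontr hy hμ
  obtain ⟨π, hπ, hinv⟩ := exists_memP2_markovStep_eq_self hΦ hr0 hr1 hcontr hy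
  have hiter : ∀ μ : Measure H, MemP2 μ → ∀ n : ℕ, MemP2 ((markovStep μξ T)^[n] μ) ∧
      W2sq ((markovStep μξ T)^[n] μ) π ≤ ENNReal.ofReal (r ^ 2) ^ n * W2sq μ π := by
    intro μ hμ n
    induction n with
    | zero => simpa using hμ
    | succ n ih =>
      rw [Function.iterate_succ_apply']
      refine ⟨hmap _ ih.1, ?_⟩
      have := ih.1.1
      have := hπ.1
      have h := W2sq_markovStep_le hΦ ENNReal.ofReal_ne_top hcontr
        ((markovStep μξ T)^[n] μ) π
      rw [hinv] at h
      refine h.trans ?_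
      rw [pow_succ' _ n, mul_assoc]
      gcongr
      exact ih.2
  refine ⟨hmap, π, hπ, hinv, fun π' hπ' hinv' => ?_, fun μ hμ n => (hiter μ hμ n).2⟩
  have := hπ.1
  have := hπ'.1
  refine eq_of_W2sq_eq_zero ?_
  have hle := (hiter π' hπ' 1).2
  rw [Function.iterate_one, hinv', pow_one] at hle
  by_contra h0
  have hlt : ENNReal.ofReal (r ^ 2) * W2sq π' π < 1 * W2sq π' π := by
    refine ENNReal.mul_lt_mul_left h0 (W2sq_lt_top hπ' hπ).ne ?_
    exact ENNReal.ofReal_lt_one.2 (by nlinarith)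
  rw [one_mul] at hlt
  exact hle.not_gt hlt
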